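/- For 0 < q < 1, (-q²;q)_∞ = (1/((q²;q⁵)_∞(q³;q⁵)_∞)) ∑_{n=0}^∞ q^{2n} b_{2n+1}(q)/(q²;q²)_n − (1/((q;q⁵)_∞(q⁴;q⁵)_∞)) ∑_{n=0}^∞ q^{2n} a_{2n+1}(q)/(q²;q²)_n. -/

import Mathlib

noncomputable def qp (q a : ℝ) (n : ℕ) : ℝ := ∏ k ∈ Finset.range n, (1 - a * q ^ k)

noncomputable def qpi (q a : ℝ) : ℝ := ∏' k : ℕ, (1 - a * q ^ k)

noncomputable def qbinom (q : ℝ) (n k : ℕ) : ℝ :=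
  if k ≤ n then qp q q n / (qp q q k * qp q q (n - k)) else 0

noncomputable def schurA (q : ℝ) (m : ℕ) : ℝ :=
  ∑' j : ℕ, if j + 2 ≤ m then q ^ (j ^ 2 + j) * qbinom q (m - j - 2) j else 0

noncomputable def schurB (q : ℝ) (m : ℕ) : ℝ :=
  ∑' j : ℕ, if j + 1 ≤ m then q ^ (j ^ 2) * qbinom q (m - j - 1) j else 0

open Filter Topology

/-- reciprocal of `(q;q)_n`, extended by zero to negative integers -/
noncomputable def rr (q : ℝ) (n : ℤ) : ℝ := if 0 ≤ n then 1 / qp q q n.toNat else 0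

lemma qp_succ (q a : ℝ) (n : ℕ) : qp q a (n+1) = qp q a n * (1 - a * q ^ n) := by
  simp [qp, Finset.prod_range_succ]

lemma qp_zero (q a : ℝ) : qp q a 0 = 1 := by simp [qp]

lemma one_sub_pos' {q : ℝ} (h0 : 0 < q) (h1 : q < 1) (k : ℕ) : 0 < 1 - q * q ^ k := by
  have : q ^ (k+1) < 1 := pow_lt_one₀ h0.le h1 (by omega)
  rw [pow_succ'] at this; linarith

lemma qp_pos {q : ℝ} (h0 : 0 < q) (h1 : q < 1) (n : ℕ) : 0 < qp q q n :=
  Finset.prod_pos fun k _ => one_sub_pos' h0 h1 k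

lemma summ_aq {q : ℝ} (a : ℝ) (h0 : 0 < q) (h1 : q < 1) : Summable fun k : ℕ => a * q ^ k :=
  (summable_geometric_of_lt_one h0.le h1).mul_left a

lemma qpi_mult {q : ℝ} (a : ℝ) (h0 : 0 < q) (h1 : q < 1) :
    Multipliable fun k : ℕ => (1 - a * q ^ k) := by
  have := multipliable_one_add_of_summable (f := fun k : ℕ => -(a * q ^ k))
    (by simpa using (summ_aq a h0 h1).abs)
  simpa [sub_eq_add_neg] using this

lemma qpi_ne {q : ℝ} (a : ℝ) (h0 : 0 < q) (h1 : q < 1) (h : ∀ k : ℕ, 1 - a * q ^ k ≠ 0) :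
    qpi q a ≠ 0 := by
  have := tprod_one_add_ne_zero_of_summable (f := fun k : ℕ => -(a * q ^ k))
    (by simpa [sub_eq_add_neg] using h) (by simpa using (summ_aq a h0 h1).abs)
  simpa [qpi, sub_eq_add_neg] using this

lemma qp_tendsto {q : ℝ} (a : ℝ) (h0 : 0 < q) (h1 : q < 1) :
    Tendsto (fun n => qp q a n) atTop (𝓝 (qpi q a)) :=
  (qpi_mult a h0 h1).tendsto_prod_tprod_nat

lemma qp_anti {q : ℝ} (h0 : 0 < q) (h1 : q < 1) : Antitone (qp q q) := by
  apply antitone_nat_of_succ_le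
  intro n
  rw [qp_succ]
  have := qp_pos h0 h1 n
  have h2 : 0 < q * q ^ n := by positivity
  nlinarith

lemma qpi_pos {q : ℝ} (h0 : 0 < q) (h1 : q < 1) : 0 < qpi q q := by
  have h := ge_of_tendsto' (qp_tendsto q h0 h1) (fun n => (qp_pos h0 h1 n).le)
  exact lt_of_le_of_ne h (Ne.symm (qpi_ne q h0 h1 fun k => (one_sub_pos' h0 h1 k).ne'))

lemma rr_neg (q : ℝ) {n : ℤ} (h : n < 0) : rr q n = 0 := by
  simp [rr, not_le.mpr h]

lemma rr_nat (q : ℝ) (n : ℕ) : rr q n = 1 / qp q q n := by simp [rr]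

lemma rr_zero (q : ℝ) : rr q 0 = 1 := by simp [rr, qp]

lemma rr_step {q : ℝ} (h0 : 0 < q) (h1 : q < 1) (n : ℤ) :
    rr q (n - 1) = (1 - q ^ n) * rr q n := by
  rcases lt_trichotomy n 0 with h | h | h
  · rw [rr_neg q h, rr_neg q (by omega)]; simp
  · subst h; rw [rr_neg q (by omega)]; simp
  · obtain ⟨m, rfl⟩ : ∃ m : ℕ, n = m + 1 := ⟨(n-1).toNat, by omega⟩
    have e : ((m:ℤ) + 1) = ((m+1 : ℕ) : ℤ) := by push_cast; ring
    rw [add_sub_cancel_right, e, rr_nat, rr_nat, qp_succ, zpow_natCast, pow_succ']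
    have := (qp_pos h0 h1 m).ne'
    have := (one_sub_pos' h0 h1 m).ne'
    field_simp

lemma rr_nonneg {q : ℝ} (h0 : 0 < q) (h1 : q < 1) (n : ℤ) : 0 ≤ rr q n := by
  unfold rr; split_ifs
  · exact (one_div_pos.mpr (qp_pos h0 h1 _)).le
  · exact le_rfl

lemma rr_le {q : ℝ} (h0 : 0 < q) (h1 : q < 1) (n : ℤ) : rr q n ≤ 1 / qpi q q := by
  unfold rr; split_ifs
  · exact one_div_le_one_div_of_le (qpi_pos h0 h1)
      ((qp_anti h0 h1).le_of_tendsto (qp_tendsto q h0 h1) _)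
  · exact (one_div_pos.mpr (qpi_pos h0 h1)).le

lemma rr_pos {q : ℝ} (h0 : 0 < q) (h1 : q < 1) {n : ℤ} (h : 0 ≤ n) : 0 < rr q n := by
  simp only [rr, if_pos h]; exact one_div_pos.mpr (qp_pos h0 h1 _)

lemma rr_tendsto {q : ℝ} (h0 : 0 < q) (h1 : q < 1) (c : ℤ) :
    Tendsto (fun n : ℕ => rr q (n + c)) atTop (𝓝 (1 / qpi q q)) := by
  have h : Tendsto (fun n : ℕ => ((n:ℤ) + c).toNat) atTop atTop := by
    apply tendsto_atTop.mpr
    intro b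
    filter_upwards [eventually_ge_atTop (b + c.natAbs)] with n hn
    omega
  have h2 := ((qp_tendsto q h0 h1).inv₀ (qpi_pos h0 h1).ne').comp h
  rw [one_div]
  refine h2.congr' ?_
  filter_upwards [eventually_ge_atTop (c.natAbs)] with n hn
  have : 0 ≤ (n:ℤ) + c := by omega
  simp [rr, this]

lemma summ_fin {f : ℤ → ℝ} (a b : ℤ) (h : ∀ k, k < a ∨ b < k → f k = 0) : Summable f := by
  apply summable_of_ne_finset_zero (s := Finset.Icc a b)
  intro k hk
  apply h
  simp only [Finset.mem_Icc] at hk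
  omega

lemma tsum_shift (f : ℤ → ℝ) (c : ℤ) : ∑' k, f (k + c) = ∑' k, f k :=
  (Equiv.addRight c).tsum_eq f

lemma summ_shift {f : ℤ → ℝ} (hf : Summable f) (c : ℤ) : Summable fun k => f (k + c) :=
  (Equiv.addRight c).summable_iff.mpr hf

/-- `k(k-1)/2` -/
def c2 (k : ℤ) : ℤ := k * (k - 1) / 2

lemma two_c2 (k : ℤ) : 2 * c2 k = k * (k - 1) := by
  unfold c2
  apply Int.mul_ediv_cancel'
  rw [mul_comm]
  have := Int.even_mul_succ_self (k-1)
  rw [sub_add_cancel] at this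
  exact this.two_dvd

lemma c2_succ (k : ℤ) : c2 (k+1) = c2 k + k := by
  have h1 := two_c2 k
  have h2 := two_c2 (k+1)
  have : 2 * c2 (k+1) = 2 * (c2 k + k) := by rw [h2, mul_add, h1]; ring
  omega

/-- theta coefficients -/
noncomputable def tg (q w : ℝ) (k : ℤ) : ℝ := (-1) ^ k * q ^ (c2 k) * w ^ k

lemma tg_succ {q w : ℝ} (h0 : 0 < q) (hw : w ≠ 0) (k : ℤ) :
    tg q w (k+1) = -(w * q ^ k) * tg q w k := by
  unfold tg
  rw [c2_succ, zpow_add₀ h0.ne', zpow_add_one₀ hw, zpow_add_one₀ (by norm_num)]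
  ring

noncomputable def FF (q w : ℝ) (M N : ℤ) : ℝ := ∑' k : ℤ, tg q w k * rr q (M - k) * rr q (N + k)

lemma FF_summ (q w : ℝ) (M N : ℤ) : Summable fun k : ℤ => tg q w k * rr q (M - k) * rr q (N + k) := by
  apply summ_fin (-N) M
  rintro k (h | h)
  · rw [rr_neg q (n := N + k) (by omega)]; simp
  · rw [rr_neg q (n := M - k) (by omega)]; simp

lemma FF_stepM {q w : ℝ} (h0 : 0 < q) (h1 : q < 1) (hw : w ≠ 0) (M N : ℤ) :
    (1 - q ^ (M + N)) * FF q w M N = (1 - w * q ^ (M-1)) * FF q w (M-1) N := by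
  have hs : FF q w (M-1) N * (-(w * q ^ (M-1))) =
      ∑' k : ℤ, q ^ (M - k) * tg q w k * rr q (M - k) * rr q (N + k - 1) := by
    rw [FF, ← tsum_mul_right]
    symm
    rw [← tsum_shift _ 1]
    apply tsum_congr; intro k
    rw [tg_succ h0 hw, show M - (k+1) = (M - 1) - k by ring, show N + (k+1) - 1 = N + k by ring,
      zpow_sub₀ h0.ne' (M-1) k]
    have := (zpow_pos h0 k).ne'
    field_simp
  have hs2 : Summable fun k : ℤ => q ^ (M - k) * tg q w k * rr q (M - k) * rr q (N + k - 1) := by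
    apply summ_fin (-N) M
    rintro k (h | h)
    · rw [rr_neg q (n := N + k - 1) (by omega)]; simp
    · rw [rr_neg q (n := M - k) (by omega)]; simp
  have : (1 - w * q ^ (M-1)) * FF q w (M-1) N = FF q w (M-1) N + FF q w (M-1) N * (-(w * q ^ (M-1))) := by ring
  rw [this, hs, FF, FF, ← tsum_mul_left, ← (FF_summ q w (M-1) N).tsum_add hs2]
  apply tsum_congr; intro k
  rw [show M - 1 - k = (M - k) - 1 by ring, rr_step h0 h1, rr_step h0 h1,
    show M + N = (M - k) + (N + k) by ring, zpow_add₀ h0.ne']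
  ring

lemma FF_stepN {q w : ℝ} (h0 : 0 < q) (h1 : q < 1) (hw : w ≠ 0) (M N : ℤ) :
    (1 - q ^ (M + N)) * FF q w M N = (1 - q / w * q ^ (N-1)) * FF q w M (N-1) := by
  have hs : FF q w M (N-1) * (-(q / w * q ^ (N-1))) =
      ∑' k : ℤ, q ^ (N + k) * tg q w k * rr q (M - k - 1) * rr q (N + k) := by
    rw [FF, ← tsum_mul_right, ← tsum_shift _ 1]
    apply tsum_congr; intro k
    rw [tg_succ h0 hw, show M - (k+1) = M - k - 1 by ring, show N - 1 + (k+1) = N + k by ring,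
      zpow_add₀ h0.ne' N k, zpow_sub_one₀ h0.ne']
    have := (zpow_pos h0 k).ne'
    field_simp
  have hs2 : Summable fun k : ℤ => q ^ (N + k) * tg q w k * rr q (M - k - 1) * rr q (N + k) := by
    apply summ_fin (-N) M
    rintro k (h | h)
    · rw [rr_neg q (n := N + k) (by omega)]; simp
    · rw [rr_neg q (n := M - k - 1) (by omega)]; simp
  have : (1 - q / w * q ^ (N-1)) * FF q w M (N-1) = FF q w M (N-1) + FF q w M (N-1) * (-(q / w * q ^ (N-1))) := by ring
  rw [this, hs, FF, FF, ← tsum_mul_left, ← (FF_summ q w M (N-1)).tsum_add hs2]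
  apply tsum_congr; intro k
  rw [show N - 1 + k = (N + k) - 1 by ring, rr_step h0 h1, rr_step h0 h1,
    show M + N = (M - k) + (N + k) by ring, zpow_add₀ h0.ne']
  ring

lemma FF_eq {q w : ℝ} (h0 : 0 < q) (h1 : q < 1) (hw : w ≠ 0) (M N : ℕ) :
    FF q w M N = rr q (M + N) * qp q w M * qp q (q / w) N := by
  induction N with
  | zero =>
    induction M with
    | zero =>
      rw [FF, tsum_eq_single 0]
      · simp [tg, rr_zero, qp_zero, c2]
      · intro k hk
        rcases lt_or_gt_of_ne hk with h | h
        · rw [rr_neg q (n := _ + k) (by simpa using h)]; simp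
        · rw [rr_neg q (n := _ - k) (by simpa using h)]; simp
    | succ M ih =>
      have h := FF_stepM h0 h1 hw ((M+1:ℕ):ℤ) ((0:ℕ):ℤ)
      have h2 := rr_step h0 h1 (((M+1:ℕ):ℤ) + ((0:ℕ):ℤ))
      have e : ((M+1:ℕ):ℤ) - 1 = M := by push_cast; ring
      have e' : ((M+1:ℕ):ℤ) + ((0:ℕ):ℤ) - 1 = M + ((0:ℕ):ℤ) := by push_cast; ring
      rw [e, ih, zpow_natCast] at h
      rw [e'] at h2
      rw [h2] at h
      have hne : (1 - q ^ (((M+1:ℕ):ℤ) + ((0:ℕ):ℤ))) ≠ 0 := by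
        have := (one_sub_pos' h0 h1 M).ne'
        rw [Nat.cast_zero, add_zero, zpow_natCast, pow_succ']; exact this
      apply mul_left_cancel₀ hne
      rw [h, qp_succ]; ring
  | succ N ih =>
      have h := FF_stepN h0 h1 hw (M:ℤ) ((N+1:ℕ):ℤ)
      have h2 := rr_step h0 h1 ((M:ℤ) + ((N+1:ℕ):ℤ))
      have e : ((N+1:ℕ):ℤ) - 1 = N := by push_cast; ring
      have e' : (M:ℤ) + ((N+1:ℕ):ℤ) - 1 = M + N := by push_cast; ring
      rw [e, ih, zpow_natCast] at h
      rw [e'] at h2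
      rw [h2] at h
      have hne : (1 - q ^ ((M:ℤ) + ((N+1:ℕ):ℤ))) ≠ 0 := by
        have := (one_sub_pos' h0 h1 (M+N)).ne'
        rw [← Nat.cast_add, zpow_natCast, ← add_assoc, pow_succ']; exact this
      apply mul_left_cancel₀ hne
      rw [h, qp_succ]; ring

lemma summ_natAbs {q : ℝ} (h0 : 0 < q) (h1 : q < 1) : Summable fun k : ℤ => q ^ k.natAbs := by
  apply Summable.of_nat_of_neg
  · simpa using summable_geometric_of_lt_one h0.le h1
  · simpa using summable_geometric_of_lt_one h0.le h1

lemma zpow_le_natAbs {q : ℝ} (h0 : 0 < q) (h1 : q < 1) {e k : ℤ} (h : |k| ≤ e) :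
    q ^ e ≤ q ^ k.natAbs := by
  rw [← zpow_natCast, Int.natCast_natAbs]
  exact zpow_le_zpow_right_of_le_one₀ h0 h1.le h

lemma tann {u : ℤ → ℝ} (hu : Summable fun k => |u k|) (v : ℕ → ℤ → ℝ) (C l : ℝ)
    (hb : ∀ n k, |v n k| ≤ C) (hl : ∀ k, Tendsto (fun n => v n k) atTop (𝓝 l)) :
    Tendsto (fun n => ∑' k, u k * v n k) atTop (𝓝 ((∑' k, u k) * l)) := by
  rw [← tsum_mul_right]
  apply tendsto_tsum_of_dominated_convergence (bound := fun k => |u k| * C) (hu.mul_right C)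
  · intro k
    exact (hl k).const_mul _
  · refine Eventually.of_forall fun n k => ?_
    rw [Real.norm_eq_abs, abs_mul]
    exact mul_le_mul_of_nonneg_left (hb n k) (abs_nonneg _)

lemma rr_abs_le {q : ℝ} (h0 : 0 < q) (h1 : q < 1) (n : ℤ) : |rr q n| ≤ 1 / qpi q q := by
  rw [abs_of_nonneg (rr_nonneg h0 h1 n)]; exact rr_le h0 h1 n

lemma rr2_abs_le {q : ℝ} (h0 : 0 < q) (h1 : q < 1) (n m : ℤ) :
    |rr q n * rr q m| ≤ (1 / qpi q q) * (1 / qpi q q) := by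
  rw [abs_mul]
  exact mul_le_mul (rr_abs_le h0 h1 n) (rr_abs_le h0 h1 m) (abs_nonneg _)
    (one_div_pos.mpr (qpi_pos h0 h1)).le

lemma rr_tendsto' {q : ℝ} (h0 : 0 < q) (h1 : q < 1) (c : ℤ) :
    Tendsto (fun n : ℕ => rr q (n - c)) atTop (𝓝 (1 / qpi q q)) := by
  simpa [sub_eq_add_neg] using rr_tendsto h0 h1 (-c)

/-- Jacobi triple product -/
lemma jtp {q w : ℝ} (h0 : 0 < q) (h1 : q < 1) (hw : w ≠ 0) (hs : Summable fun k => |tg q w k|) :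
    ∑' k, tg q w k = qpi q q * qpi q w * qpi q (q / w) := by
  have h := tann hs (fun n k => rr q (n - k) * rr q (n + k)) _ _
    (fun n k => rr2_abs_le h0 h1 _ _)
    (fun k => (rr_tendsto' h0 h1 k).mul (rr_tendsto h0 h1 k))
  have hd : Tendsto (fun n : ℕ => rr q ((n:ℤ) + n)) atTop (𝓝 (1 / qpi q q)) := by
    have h2 : Tendsto (fun n : ℕ => n + n) atTop atTop :=
      tendsto_atTop_mono (fun n => Nat.le_add_left n n) tendsto_id
    have := (rr_tendsto h0 h1 0).comp h2
    simpa [Function.comp_def] using this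
  have h' := (hd.mul (qp_tendsto w h0 h1)).mul (qp_tendsto (q/w) h0 h1)
  have he : ∀ n : ℕ, ∑' k, tg q w k * (rr q (n - k) * rr q (n + k)) =
      rr q ((n:ℤ) + n) * qp q w n * qp q (q/w) n := by
    intro n
    rw [← FF_eq h0 h1 hw n n, FF]
    exact tsum_congr fun k => by ring
  simp only [he] at h
  have := tendsto_nhds_unique h h'
  have hp := (qpi_pos h0 h1).ne'
  field_simp at this
  linarith

lemma euler {q w : ℝ} (h0 : 0 < q) (h1 : q < 1) (hw : w ≠ 0)
    (hs : Summable fun k => |tg q w k * rr q k|) :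
    ∑' k, tg q w k * rr q k = qpi q w := by
  have h := tann hs (fun n k => rr q (n - k)) _ _
    (fun n k => rr_abs_le h0 h1 _) (fun k => (rr_tendsto' h0 h1 k))
  have h' := (rr_tendsto h0 h1 0).mul (qp_tendsto w h0 h1)
  have he : ∀ n : ℕ, ∑' k, tg q w k * rr q k * rr q (n - k) = rr q ((n:ℤ) + 0) * qp q w n := by
    intro n
    have := FF_eq h0 h1 hw n 0
    rw [FF, qp_zero, mul_one] at this
    rw [Nat.cast_zero] at this
    rw [← this]
    exact tsum_congr fun k => by rw [zero_add]; ring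
  simp only [he] at h
  have := tendsto_nhds_unique h h'
  have hp := (qpi_pos h0 h1).ne'
  field_simp at this
  linarith

lemma KK_summ (q : ℝ) (m n c : ℤ) (g : ℤ → ℝ) :
    Summable fun i : ℤ => g i * rr q (i - c) * rr q (i + m) * rr q (n - i) := by
  apply summ_fin c n
  rintro k (h | h)
  · rw [rr_neg q (n := k - c) (by omega)]; simp
  · rw [rr_neg q (n := n - k) (by omega)]; simp

lemma KK_nat {q : ℝ} (h0 : 0 < q) (h1 : q < 1) (n : ℕ) : ∀ m : ℤ,
    ∑' i : ℤ, q ^ (i * (i + m)) * rr q (i - 0) * rr q (i + m) * rr q (n - i) =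
      rr q n * rr q (n + m) := by
  induction n with
  | zero =>
    intro m
    rw [tsum_eq_single 0]
    · simp [rr_zero]
    · intro k hk
      rcases lt_or_gt_of_ne hk with h | h
      · rw [rr_neg q (n := k - 0) (by simpa using h)]; simp
      · rw [rr_neg q (n := _ - k) (by simpa using h)]; simp
  | succ n ih =>
    intro m
    have hne : (1 - q ^ ((n+1:ℕ):ℤ)) ≠ 0 := by
      rw [zpow_natCast, pow_succ']; exact (one_sub_pos' h0 h1 n).ne'
    apply mul_left_cancel₀ hne
    have hs : q ^ (n + 1 + m) * (rr q n * rr q (n + (m+1))) = ∑' i : ℤ,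
        (q ^ ((n+1:ℕ) - i + i * (i + m))) * rr q (i - 1) * rr q (i + m) * rr q ((n+1:ℕ) - i) := by
      rw [← ih (m+1), ← tsum_mul_left]
      symm
      rw [← tsum_shift _ 1]
      apply tsum_congr; intro i
      rw [show i + 1 - 1 = i - 0 by ring, show i + 1 + m = i + (m+1) by ring,
        show ((n+1:ℕ):ℤ) - (i+1) = n - i by push_cast; ring, ← mul_assoc, ← mul_assoc, ← mul_assoc,
        ← zpow_add₀ h0.ne']
      congr 4
      ring
    have hr : (1 - q ^ ((n+1:ℕ):ℤ)) * (rr q (n+1:ℕ) * rr q ((n+1:ℕ) + m)) =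
        rr q n * rr q (n + m) + q ^ (n + 1 + m) * (rr q n * rr q (n + (m+1))) := by
      rw [← mul_assoc, ← rr_step h0 h1, show ((n+1:ℕ):ℤ) - 1 = n by push_cast; ring,
        show (n:ℤ) + m = (n + 1 + m) - 1 by ring, rr_step h0 h1,
        show (n:ℤ) + (m + 1) = n + 1 + m by ring]
      push_cast
      ring
    rw [hr, hs, ← ih m, ← tsum_mul_left, ← (KK_summ q _ _ _ _).tsum_add (KK_summ q _ _ _ _)]
    apply tsum_congr; intro i
    rw [show (n:ℤ) - i = ((n+1:ℕ) - i) - 1 by push_cast; ring, rr_step h0 h1 (_ - _), rr_step h0 h1 i,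
      sub_zero, zpow_add₀ h0.ne', show ((n+1:ℕ):ℤ) = ((n+1:ℕ) - i) + i by ring, zpow_add₀ h0.ne' _ i]
    simp only [sub_add_cancel]
    ring

lemma KK {q : ℝ} (h0 : 0 < q) (h1 : q < 1) (n m : ℤ) :
    ∑' i : ℤ, q ^ (i * (i + m)) * rr q (i - 0) * rr q (i + m) * rr q (n - i) =
      rr q n * rr q (n + m) := by
  rcases lt_or_ge n 0 with h | h
  · rw [rr_neg q h, zero_mul]
    convert tsum_zero with i
    rcases lt_or_ge i 0 with hi | hi
    · rw [rr_neg q (n := i - 0) (by omega)]; simp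
    · rw [rr_neg q (n := n - i) (by omega)]; simp
  · obtain ⟨k, rfl⟩ := Int.eq_ofNat_of_zero_le h
    exact KK_nat h0 h1 k m

lemma KK2 {q : ℝ} (h0 : 0 < q) (h1 : q < 1) (e k N : ℤ) :
    ∑' j : ℤ, q ^ (j * (j + e)) * rr q (j - k) * rr q (j + (k + e)) * rr q (N - j) =
      q ^ (k * (k + e)) * (rr q (N - k) * rr q (N + k + e)) := by
  rw [← tsum_shift _ k, show N + k + e = (N - k) + (2 * k + e) by ring,
    ← KK h0 h1 (N - k) (2 * k + e), ← tsum_mul_left]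
  apply tsum_congr; intro i
  rw [show i + k - k = i - 0 by ring, show i + k + (k + e) = i + (2 * k + e) by ring,
    show N - (i + k) = N - k - i by ring, ← mul_assoc, ← mul_assoc, ← mul_assoc, ← zpow_add₀ h0.ne']
  congr 4
  ring

lemma bailey {q : ℝ} (h0 : 0 < q) (h1 : q < 1) {e : ℤ} (he : 0 ≤ e) (α β : ℤ → ℝ)
    (h : ∀ j, ∑' k, α k * (rr q (j - k) * rr q (j + k + e)) = β j) (N : ℤ) :
    ∑' k, (α k * q ^ (k * (k + e))) * (rr q (N - k) * rr q (N + k + e)) =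
      ∑' j, q ^ (j * (j + e)) * rr q (N - j) * β j := by
  have hs : Summable (Function.uncurry fun k j : ℤ => α k *
      (q ^ (j * (j + e)) * rr q (j - k) * rr q (j + (k + e)) * rr q (N - j))) := by
    apply summable_of_ne_finset_zero (s := Finset.Icc (-N-e) N ×ˢ Finset.Icc (-e) N)
    rintro ⟨k, j⟩ hk
    simp only [Finset.mem_product, Finset.mem_Icc] at hk
    simp only [Function.uncurry_apply_pair]
    by_cases a1 : j - k < 0
    · rw [rr_neg q a1]; simp
    by_cases a2 : j + (k + e) < 0
    · rw [rr_neg q a2]; simp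
    by_cases a3 : N - j < 0
    · rw [rr_neg q a3]; simp
    omega
  calc _ = ∑' k, ∑' j, α k *
      (q ^ (j * (j + e)) * rr q (j - k) * rr q (j + (k + e)) * rr q (N - j)) := by
        apply tsum_congr; intro k
        rw [tsum_mul_left, KK2 h0 h1]; ring
    _ = ∑' j, ∑' k, α k *
      (q ^ (j * (j + e)) * rr q (j - k) * rr q (j + (k + e)) * rr q (N - j)) := hs.tsum_comm.symm
    _ = _ := by
        apply tsum_congr; intro j
        rw [← h, ← tsum_mul_left]
        apply tsum_congr; intro k
        rw [← add_assoc]; ring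

lemma delta {q : ℝ} (h0 : 0 < q) (h1 : q < 1) {e : ℕ} (he : e ≤ 1) (j : ℤ) :
    ∑' k, tg q 1 k * (rr q (j - k) * rr q (j + k + e)) = if j = 0 then 1 else 0 := by
  rcases lt_or_ge j 0 with h | h
  · rw [if_neg h.ne]
    convert tsum_zero with k
    by_cases a1 : j - k < 0
    · rw [rr_neg q a1]; simp
    · rw [rr_neg q (n := j + k + e) (by omega)]; simp
  · obtain ⟨n, rfl⟩ := Int.eq_ofNat_of_zero_le h
    have := FF_eq h0 h1 one_ne_zero n (n + e)
    rw [FF] at this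
    have h2 : ∑' k, tg q 1 k * (rr q (n - k) * rr q (n + k + e)) =
        ∑' k, tg q 1 k * rr q (n - k) * rr q ((n + e : ℕ) + k) := by
      apply tsum_congr; intro k
      rw [show (n:ℤ) + k + e = (n + e : ℕ) + k by push_cast; ring]; ring
    rw [h2, this]
    rcases Nat.eq_zero_or_pos n with hn | hn
    · subst hn
      have := (qp_pos h0 h1 e).ne'
      simp only [Nat.cast_zero, zero_add, qp_zero, rr_nat, if_true, div_one]
      field_simp
    · rw [if_neg (by omega)]
      have : qp q 1 n = 0 := Finset.prod_eq_zero (Finset.mem_range.mpr hn) (by simp)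
      rw [this]; ring

noncomputable def SS (q : ℝ) (m : ℤ) : ℝ := ∑' j : ℤ, q ^ (j * (j + m)) * rr q j

lemma SS_term_le {q : ℝ} (h0 : 0 < q) (h1 : q < 1) {m : ℤ} (hm : 0 ≤ m) (j : ℤ) :
    q ^ (j * (j + m)) * rr q j ≤ q ^ j.natAbs * (1 / qpi q q) := by
  rcases lt_or_ge j 0 with h | h
  · rw [rr_neg q h, mul_zero]
    exact mul_nonneg (by positivity) (one_div_pos.mpr (qpi_pos h0 h1)).le
  · apply mul_le_mul _ (rr_le h0 h1 j) (rr_nonneg h0 h1 j) (by positivity)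
    apply zpow_le_natAbs h0 h1
    rw [abs_of_nonneg h]
    rcases h.eq_or_lt with h | h
    · simp [← h]
    · nlinarith

lemma SS_nonneg_term {q : ℝ} (h0 : 0 < q) (h1 : q < 1) (e j : ℤ) : 0 ≤ q ^ e * rr q j :=
  mul_nonneg (zpow_pos h0 _).le (rr_nonneg h0 h1 _)

lemma SS_summ {q : ℝ} (h0 : 0 < q) (h1 : q < 1) {m : ℤ} (hm : 0 ≤ m) :
    Summable fun j : ℤ => q ^ (j * (j + m)) * rr q j :=
  Summable.of_nonneg_of_le (fun j => SS_nonneg_term h0 h1 _ _) (SS_term_le h0 h1 hm)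
    ((summ_natAbs h0 h1).mul_right _)

lemma SS_rec {q : ℝ} (h0 : 0 < q) (h1 : q < 1) {m : ℤ} (hm : 0 ≤ m) :
    SS q m - SS q (m+1) = q ^ (m+1) * SS q (m+2) := by
  have hs := SS_summ h0 h1 hm
  have hs' := SS_summ h0 h1 (m := m+1) (by omega)
  rw [SS, SS, SS, ← hs.tsum_sub hs', ← tsum_mul_left, ← tsum_shift _ 1]
  apply tsum_congr; intro j
  have e1 : (j + 1) * (j + 1 + (m + 1)) = (j+1) * (j+1+m) + (j + 1) := by ring
  rw [e1, zpow_add₀ h0.ne' _ (j+1),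
    show (j+1) * (j+1+m) = (m + 1) + j * (j + (m+2)) by ring, zpow_add₀ h0.ne' (m+1)]
  have := rr_step h0 h1 (j+1)
  rw [add_sub_cancel_right] at this
  rw [this]; ring

lemma abs_tg {q w : ℝ} (h0 : 0 < q) (k : ℤ) : |tg q w k| = q ^ (c2 k) * |w| ^ k := by
  unfold tg
  rw [abs_mul, abs_mul, abs_zpow, abs_zpow, abs_zpow, abs_neg, abs_one, one_zpow, one_mul,
    abs_of_pos h0]

lemma exp_bound (k e : ℤ) (he : 0 ≤ e) (he1 : e ≤ 1) : |k| ≤ c2 k + 2 * (k * (k + e)) := by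
  have h := two_c2 k
  have : 2 * |k| ≤ 2 * (c2 k + 2 * (k * (k + e))) := by
    rw [mul_add, h]
    rcases (show e = 0 ∨ e = 1 by omega) with rfl | rfl
    · rcases abs_cases k with ⟨h1, h2⟩ | ⟨h1, h2⟩ <;> rw [h1]
      · rcases h2.eq_or_lt with h | h
        · simp [← h]
        · nlinarith
      · nlinarith
    · rcases abs_cases k with ⟨h1, h2⟩ | ⟨h1, h2⟩ <;> rw [h1] <;> nlinarith
  omega

lemma tg5 {q : ℝ} (h0 : 0 < q) (e : ℕ) (k : ℤ) :
    tg q 1 k * q ^ (k * (k + e)) * q ^ (k * (k + e)) = tg (q^5) (q ^ (2 + 2 * e)) k := by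
  unfold tg
  rw [one_zpow, mul_one, mul_assoc, mul_assoc, mul_assoc, ← zpow_natCast, ← zpow_natCast, ← zpow_mul, ← zpow_mul,
    ← zpow_add₀ h0.ne', ← zpow_add₀ h0.ne', ← zpow_add₀ h0.ne']
  congr 2
  have h := two_c2 k
  push_cast
  linarith

lemma tg5_summ {q : ℝ} (h0 : 0 < q) (h1 : q < 1) {e : ℕ} (he : e ≤ 1) :
    Summable fun k => |tg (q^5) (q ^ (2 + 2 * e)) k| := by
  apply Summable.of_nonneg_of_le (fun k => abs_nonneg _) _ (summ_natAbs h0 h1)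
  intro k
  rw [← tg5 h0, abs_mul, abs_mul, abs_tg h0, abs_one, one_zpow, mul_one,
    abs_of_pos (zpow_pos h0 _), ← zpow_add₀ h0.ne', ← zpow_add₀ h0.ne']
  apply zpow_le_natAbs h0 h1
  have := exp_bound k e (by omega) (by omega)
  linarith

lemma RR0 {q : ℝ} (h0 : 0 < q) (h1 : q < 1) {e : ℕ} (he : e ≤ 1) :
    SS q e * qpi q q = ∑' k, tg (q^5) (q ^ (2 + 2 * e)) k := by
  have b1 := bailey h0 h1 (Int.natCast_nonneg e) _ _ (delta h0 h1 he)
  have b2 := bailey h0 h1 (Int.natCast_nonneg e) _ (fun j => rr q j) (by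
    intro j
    rw [b1, tsum_eq_single 0]
    · simp
    · intro k hk; simp [hk])
  simp only [tg5 h0] at b2
  have l1 := tann (tg5_summ h0 h1 he) (fun n k => rr q (n - k) * rr q (n + k + e)) _ _
    (fun n k => rr2_abs_le h0 h1 _ _)
    (fun k => (rr_tendsto' h0 h1 k).mul ((rr_tendsto h0 h1 (k + e)).congr
      fun n => by rw [add_assoc]))
  have l2 := tann (SS_summ h0 h1 (Int.natCast_nonneg e)).abs (fun n k => rr q (n - k)) _ _
    (fun n k => rr_abs_le h0 h1 _) (fun k => (rr_tendsto' h0 h1 k))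
  have he : ∀ n : ℕ, ∑' k, tg (q^5) (q ^ (2 + 2 * e)) k * (rr q (n - k) * rr q (n + k + e)) =
     ∑' k : ℤ, q ^ (k * (k + e)) * rr q k * rr q (n - k) := by
    intro n
    rw [b2]
    exact tsum_congr fun j => by ring
  simp only [he] at l1
  have := tendsto_nhds_unique l1 l2
  have hp := (qpi_pos h0 h1).ne'
  rw [SS]
  field_simp at this
  linarith

lemma qp_five (q a : ℝ) (n : ℕ) : qp q a (5 * n) = qp (q^5) a n * qp (q^5) (a * q) n *
    qp (q^5) (a * q^2) n * qp (q^5) (a * q^3) n * qp (q^5) (a * q^4) n := by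
  induction n with
  | zero => simp [qp_zero]
  | succ n ih =>
    rw [show 5 * (n+1) = 5 * n + 1 + 1 + 1 + 1 + 1 by ring]
    simp only [qp_succ, ih]
    ring

lemma qpi_five {q : ℝ} (a : ℝ) (h0 : 0 < q) (h1 : q < 1) : qpi q a = qpi (q^5) a * qpi (q^5) (a * q) *
    qpi (q^5) (a * q^2) * qpi (q^5) (a * q^3) * qpi (q^5) (a * q^4) := by
  have h5 : 0 < q^5 := by positivity
  have h51 : q^5 < 1 := pow_lt_one₀ h0.le h1 (by norm_num)
  have h2 : Tendsto (fun n : ℕ => 5 * n) atTop atTop :=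
      tendsto_atTop_mono (fun n => by simp only [id]; omega) tendsto_id
  have l1 := (qp_tendsto a h0 h1).comp h2
  have t := fun b => qp_tendsto b h5 h51
  have l2 := ((((t a).mul (t (a*q))).mul (t (a*q^2))).mul (t (a * q^3))).mul (t (a * q^4))
  simp only [Function.comp_def, qp_five] at l1
  exact tendsto_nhds_unique l1 l2

lemma qpi5_ne {q : ℝ} (h0 : 0 < q) (h1 : q < 1) {i : ℕ} (hi : i ≠ 0) : qpi (q^5) (q^i) ≠ 0 := by
  have h5 : 0 < q^5 := by positivity
  have h51 : q^5 < 1 := pow_lt_one₀ h0.le h1 (by norm_num)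
  apply qpi_ne _ h5 h51
  intro k
  rw [← pow_mul, ← pow_add]
  have : q ^ (i + 5 * k) < 1 := pow_lt_one₀ h0.le h1 (by omega)
  linarith

lemma RR1 {q : ℝ} (h0 : 0 < q) (h1 : q < 1) :
    SS q 0 = 1 / (qpi (q^5) q * qpi (q^5) (q^4)) ∧
    SS q 1 = 1 / (qpi (q^5) (q^2) * qpi (q^5) (q^3)) := by
  have h5 : 0 < q^5 := by positivity
  have h51 : q^5 < 1 := pow_lt_one₀ h0.le h1 (by norm_num)
  have n := fun i hi => qpi5_ne h0 h1 (i := i) hi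
  have n1 := n 1 (by norm_num)
  have n2 := n 2 (by norm_num)
  have n3 := n 3 (by norm_num)
  have n4 := n 4 (by norm_num)
  have n5 := n 5 (by norm_num)
  rw [pow_one] at n1
  have f := qpi_five q h0 h1
  rw [show q * q = q^2 by ring, show q * q^2 = q^3 by ring, show q * q^3 = q^4 by ring,
    show q * q^4 = q^5 by ring] at f
  constructor
  · have a := RR0 h0 h1 (e := 0) (by norm_num)
    have b := jtp h5 h51 (w := q^(2+2*0)) (by positivity) (tg5_summ h0 h1 (by norm_num))
    rw [b, f] at a
    have e : q^5 / q^(2+2*0) = q^3 := by field_simp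
    rw [e] at a
    norm_num at a
    have hx : qpi (q^5) (q^2) * qpi (q^5) (q^3) * qpi (q^5) (q^5) ≠ 0 := by positivity
    field_simp
    apply mul_left_cancel₀ hx
    linear_combination a
  · have a := RR0 h0 h1 (e := 1) (by norm_num)
    have b := jtp h5 h51 (w := q^(2+2*1)) (by positivity) (tg5_summ h0 h1 (by norm_num))
    rw [b, f] at a
    have e : q^5 / q^(2+2*1) = q := by field_simp
    rw [e] at a
    norm_num at a
    have hx : qpi (q^5) (q^4) * qpi (q^5) q * qpi (q^5) (q^5) ≠ 0 := by positivity
    field_simp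
    apply mul_left_cancel₀ hx
    linear_combination a

lemma q2 {q : ℝ} (h0 : 0 < q) (h1 : q < 1) : 0 < q^2 ∧ q^2 < 1 :=
  ⟨by positivity, pow_lt_one₀ h0.le h1 (by norm_num)⟩

noncomputable def GG (q : ℝ) (M : ℤ) : ℝ :=
  ∑' n : ℤ, q ^ (2 * n * n - 2 * M * n + n) * rr (q^2) n * rr q (M - 2 * n)

lemma GG_summ (q : ℝ) (M : ℤ) (g : ℤ → ℝ) (a b : ℤ) :
    Summable fun n => g n * rr (q^2) (n - a) * rr q (M - 2 * n - b) := by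
  apply summ_fin a (|M| + |b|)
  rintro k (h | h)
  · rw [rr_neg (q^2) (n := k - a) (by omega)]; simp
  · rw [rr_neg q (n := M - 2 * k - b)]
    · simp
    · have := abs_nonneg M
      have := abs_nonneg b
      have := le_abs_self M
      have := neg_abs_le b
      omega

lemma GG_step {q : ℝ} (h0 : 0 < q) (h1 : q < 1) (M : ℤ) :
    (1 - q ^ M) * GG q M = q ^ (1 - M) * GG q (M - 1) := by
  obtain ⟨g0, g1⟩ := q2 h0 h1
  have hs : ∑' n : ℤ, q ^ (2 * n * n - 2 * M * n + n + (M - 2 * n)) * rr (q^2) (n - 1) * rr q (M - 2 * n - 0) =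
      ∑' n : ℤ, (q ^ (1 - M + (2 * n * n - 2 * (M-1) * n + n)) -
        q ^ (2 * n * n - 2 * M * n + n)) * rr (q^2) (n - 0) * rr q (M - 2 * n - 1) := by
    rw [← tsum_shift _ 1]
    apply tsum_congr; intro n
    rw [add_sub_cancel_right, sub_zero, sub_zero, show M - 2 * (n+1) = (M - 2 * n - 1) - 1 by ring,
      rr_step h0 h1 (M - 2 * n - 1),
      show 2 * (n+1) * (n+1) - 2 * M * (n+1) + (n+1) + (M - 2 * n - 1 - 1) =
        1 - M + (2 * n * n - 2 * (M-1) * n + n) by ring,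
      show 2 * n * n - 2 * M * n + n = (1 - M + (2 * n * n - 2 * (M-1) * n + n)) + (M - 2 * n - 1) by ring,
      zpow_add₀ h0.ne' _ (M - 2 * n - 1)]
    ring
  have hr : q ^ (1 - M) * GG q (M - 1) = ∑' n : ℤ, q ^ (2 * n * n - 2 * M * n + n) * rr (q^2) (n - 0) * rr q (M - 2 * n - 1) +
    ∑' n : ℤ, q ^ (2 * n * n - 2 * M * n + n + (M - 2 * n)) * rr (q^2) (n - 1) * rr q (M - 2 * n - 0) := by
    rw [hs, ← (GG_summ q M _ 0 1).tsum_add (GG_summ q M _ 0 1), GG, ← tsum_mul_left]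
    apply tsum_congr; intro n
    rw [sub_zero, show M - 1 - 2 * n = M - 2 * n - 1 by ring, zpow_add₀ h0.ne' (1 - M)]
    ring
  rw [hr, ← (GG_summ q M _ 0 1).tsum_add (GG_summ q M _ 1 0), GG, ← tsum_mul_left]
  apply tsum_congr; intro n
  have e : ((q^2 : ℝ)) ^ n = q ^ (2 * n) := by rw [← zpow_natCast, ← zpow_mul]; rfl
  rw [sub_zero, sub_zero, rr_step h0 h1, rr_step g0 g1, e, zpow_add₀ h0.ne' _ (M - 2 * n),
    show q ^ M = q ^ (M - 2 * n) * q ^ (2 * n) by rw [← zpow_add₀ h0.ne']; congr 1; ring]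
  ring

lemma GG_eq {q : ℝ} (h0 : 0 < q) (h1 : q < 1) (M : ℤ) : GG q M = q ^ (- c2 M) * rr q M := by
  rcases lt_or_ge M 0 with h | h
  · rw [rr_neg q h, mul_zero, GG]
    convert tsum_zero with n
    rcases lt_or_ge n 0 with hi | hi
    · rw [rr_neg _ hi]; simp
    · rw [rr_neg q (n := M - 2 * n) (by omega)]; simp
  · obtain ⟨m, rfl⟩ := Int.eq_ofNat_of_zero_le h
    clear h
    induction m with
    | zero =>
      rw [GG, tsum_eq_single 0]
      · simp [rr_zero, c2]
      · intro n hn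
        rcases lt_or_gt_of_ne hn with h | h
        · rw [rr_neg _ h]; simp
        · rw [rr_neg q (n := _ - 2 * n) (by simpa using h)]; simp
    | succ m ih =>
      have s := GG_step h0 h1 ((m+1:ℕ):ℤ)
      have r := rr_step h0 h1 ((m+1:ℕ):ℤ)
      have hne : (1 - q ^ ((m+1:ℕ):ℤ)) ≠ 0 := by
        rw [zpow_natCast, pow_succ']; exact (one_sub_pos' h0 h1 m).ne'
      apply mul_left_cancel₀ hne
      rw [show ((m+1:ℕ):ℤ) - 1 = m by push_cast; ring] at s r
      rw [s, ih, r, ← mul_assoc, ← zpow_add₀ h0.ne']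
      have : 1 - ((m+1:ℕ):ℤ) + - c2 m = - c2 ((m+1:ℕ):ℤ) := by
        push_cast; rw [c2_succ]; ring
      rw [this]; ring

def shear : ℤ × ℤ ≃ ℤ × ℤ where
  toFun x := (x.1, x.2 - 2 * x.1)
  invFun x := (x.1, x.2 + 2 * x.1)
  left_inv x := by simp
  right_inv x := by simp

lemma dbl {q : ℝ} (h0 : 0 < q) (h1 : q < 1) :
    ∑' n : ℤ, rr (q^2) n * q ^ (2 * n * n + 3 * n) * SS q (2 * n + 1) = qpi q (-q^2) := by
  obtain ⟨g0, g1⟩ := q2 h0 h1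
  have C0 := (one_div_pos.mpr (qpi_pos h0 h1)).le
  have D0 := (one_div_pos.mpr (qpi_pos g0 g1)).le
  have hs : Summable (fun x : ℤ × ℤ => rr (q^2) x.1 * q ^ (2 * x.1 * x.1 + 3 * x.1) *
      (q ^ (x.2 * (x.2 + (2 * x.1 + 1))) * rr q x.2)) := by
    apply Summable.of_nonneg_of_le (g := _) (f := fun x : ℤ × ℤ =>
      (1 / qpi (q^2) (q^2) * q ^ x.1.natAbs) * (q ^ x.2.natAbs * (1 / qpi q q)))
    · intro x
      exact mul_nonneg (mul_nonneg (rr_nonneg g0 g1 _) (zpow_pos h0 _).le) (SS_nonneg_term h0 h1 _ _)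
    · rintro ⟨n, k⟩
      dsimp only
      rcases lt_or_ge n 0 with h | h
      · rw [rr_neg _ h, zero_mul, zero_mul]; positivity
      · apply mul_le_mul _ (SS_term_le h0 h1 (by omega) k) (SS_nonneg_term h0 h1 _ _) (by positivity)
        apply mul_le_mul (rr_le g0 g1 n) _ (zpow_pos h0 _).le D0
        apply zpow_le_natAbs h0 h1
        rw [abs_of_nonneg h]
        nlinarith
    · exact ((summ_natAbs h0 h1).mul_left _).mul_of_nonneg ((summ_natAbs h0 h1).mul_right _)
        (fun k => by positivity) (fun k => by positivity)
  have hs2 := shear.summable_iff.mpr hs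
  have e1 : ∑' n : ℤ, rr (q^2) n * q ^ (2 * n * n + 3 * n) * SS q (2 * n + 1) =
      ∑' n : ℤ, ∑' M : ℤ, rr (q^2) n * q ^ (2 * n * n + 3 * n) *
      (q ^ ((M - 2 * n) * ((M - 2 * n) + (2 * n + 1))) * rr q (M - 2 * n)) := by
    apply tsum_congr; intro n
    rw [SS, ← tsum_mul_left, ← tsum_shift _ (-(2 * n))]
    rfl
  have hs3 : Summable (Function.uncurry fun n M : ℤ => rr (q^2) n * q ^ (2 * n * n + 3 * n) *
      (q ^ ((M - 2 * n) * ((M - 2 * n) + (2 * n + 1))) * rr q (M - 2 * n))) := hs2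
  rw [e1, ← hs3.tsum_comm]
  have e2 : ∀ M : ℤ, ∑' n : ℤ, rr (q^2) n * q ^ (2 * n * n + 3 * n) *
      (q ^ ((M - 2 * n) * ((M - 2 * n) + (2 * n + 1))) * rr q (M - 2 * n)) =
      tg q (-q^2) M * rr q M := by
    intro M
    have : tg q (-q^2) M * rr q M = q ^ (M * M + M) * GG q M := by
      rw [GG_eq h0 h1, tg, ← mul_assoc, ← zpow_add₀ h0.ne', neg_eq_neg_one_mul (q^2), mul_zpow,
        show (-1:ℝ) ^ M * q ^ c2 M * ((-1) ^ M * (q^2) ^ M) =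
          ((-1) ^ M * (-1) ^ M) * (q ^ c2 M * (q^2) ^ M) by ring, ← mul_zpow, ← zpow_natCast,
          ← zpow_mul, ← zpow_add₀ h0.ne']
      norm_num
      left
      congr 1
      have := two_c2 M
      linarith
    rw [this, GG, ← tsum_mul_left]
    apply tsum_congr; intro n
    have hz : q ^ (2 * n * n + 3 * n) * q ^ ((M - 2 * n) * ((M - 2 * n) + (2 * n + 1))) =
        q ^ (M * M + M) * q ^ (2 * n * n - 2 * M * n + n) := by
      rw [← zpow_add₀ h0.ne', ← zpow_add₀ h0.ne']
      congr 1
      ring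
    linear_combination (rr (q^2) n * rr q (M - 2 * n)) * hz
  simp only [e2]
  apply euler h0 h1 (neg_ne_zero.mpr g0.ne')
  apply Summable.of_nonneg_of_le (fun k => abs_nonneg _) _ ((summ_natAbs h0 h1).mul_right (1 / qpi q q))
  intro k
  rw [abs_mul, abs_tg h0, abs_of_nonneg (rr_nonneg h0 h1 k), abs_neg, abs_of_pos g0]
  rcases lt_or_ge k 0 with h | h
  · rw [rr_neg _ h, mul_zero]; positivity
  · apply mul_le_mul _ (rr_le h0 h1 k) (rr_nonneg h0 h1 k) (by positivity)
    rw [← zpow_natCast q 2, ← zpow_mul, ← zpow_add₀ h0.ne']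
    apply zpow_le_natAbs h0 h1
    rw [abs_of_nonneg h]
    have := two_c2 k
    push_cast
    nlinarith

lemma qbinom_pascal {q : ℝ} (h0 : 0 < q) (h1 : q < 1) (n j : ℕ) :
    qbinom q (n+1) (j+1) = qbinom q n (j+1) + q ^ (n - j) * qbinom q n j := by
  rcases lt_trichotomy j n with h | h | h
  · obtain ⟨d, rfl⟩ : ∃ d, n = j + d + 1 := ⟨n - j - 1, by omega⟩
    unfold qbinom
    rw [if_pos (by omega), if_pos (by omega), if_pos (by omega),
      show j + d + 1 + 1 - (j + 1) = d + 1 by omega, show j + d + 1 - (j + 1) = d by omega,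
      show j + d + 1 - j = d + 1 by omega, qp_succ q q (j + d + 1), qp_succ q q j, qp_succ q q d]
    have := (qp_pos h0 h1 j).ne'
    have := (qp_pos h0 h1 d).ne'
    have := (one_sub_pos' h0 h1 j).ne'
    have := (one_sub_pos' h0 h1 d).ne'
    field_simp
    ring
  · subst h
    have a := (qp_pos h0 h1 j).ne'
    have b := (qp_pos h0 h1 (j+1)).ne'
    simp [qbinom, qp_zero, a, b]
  · unfold qbinom
    rw [if_neg (by omega), if_neg (by omega), if_neg (by omega)]; simp

lemma qbinom_zero {q : ℝ} (h0 : 0 < q) (h1 : q < 1) (n : ℕ) : qbinom q n 0 = 1 := by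
  have a := (qp_pos h0 h1 n).ne'
  simp [qbinom, qp_zero, a]

lemma qbinom_big (q : ℝ) {n j : ℕ} (h : n < j) : qbinom q n j = 0 := by
  rw [qbinom, if_neg (by omega)]

lemma qbinom_nonneg {q : ℝ} (h0 : 0 < q) (h1 : q < 1) (n j : ℕ) : 0 ≤ qbinom q n j := by
  have := qp_pos h0 h1
  unfold qbinom
  split_ifs
  · exact (div_pos (this _) (mul_pos (this _) (this _))).le
  · exact le_rfl

lemma qbinom_le {q : ℝ} (h0 : 0 < q) (h1 : q < 1) (n j : ℕ) :
    qbinom q n j ≤ (1 / qpi q q) * (1 / qpi q q) := by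
  have hp := qpi_pos h0 h1
  unfold qbinom
  split_ifs
  · have a1 : qp q q n ≤ 1 := by
      have := qp_anti h0 h1 (Nat.zero_le n)
      rwa [qp_zero] at this
    have e : qp q q n / (qp q q j * qp q q (n - j)) = qp q q n * (rr q j * rr q ((n - j : ℕ):ℤ)) := by
      rw [rr_nat, rr_nat]
      have := (qp_pos h0 h1 j).ne'
      have := (qp_pos h0 h1 (n-j)).ne'
      field_simp
    rw [e]
    have b := rr2_abs_le h0 h1 j ((n - j : ℕ):ℤ)
    have c := mul_nonneg (rr_nonneg h0 h1 j) (rr_nonneg h0 h1 ((n - j : ℕ):ℤ))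
    rw [abs_of_nonneg c] at b
    nlinarith [qp_pos h0 h1 n]
  · positivity

noncomputable def tA (q : ℝ) (m j : ℕ) : ℝ :=
  if j + 2 ≤ m then q ^ (j ^ 2 + j) * qbinom q (m - j - 2) j else 0

noncomputable def tB (q : ℝ) (m j : ℕ) : ℝ :=
  if j + 1 ≤ m then q ^ (j ^ 2) * qbinom q (m - j - 1) j else 0

lemma tA_bd {q : ℝ} (h0 : 0 < q) (h1 : q < 1) (m j : ℕ) :
    0 ≤ tA q m j ∧ tA q m j ≤ q ^ j * ((1 / qpi q q) * (1 / qpi q q)) := by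
  have hp := qpi_pos h0 h1
  unfold tA
  split_ifs
  · refine ⟨mul_nonneg (by positivity) (qbinom_nonneg h0 h1 _ _), ?_⟩
    apply mul_le_mul _ (qbinom_le h0 h1 _ _) (qbinom_nonneg h0 h1 _ _) (by positivity)
    exact pow_le_pow_of_le_one h0.le h1.le (by nlinarith)
  · exact ⟨le_rfl, by positivity⟩

lemma tB_bd {q : ℝ} (h0 : 0 < q) (h1 : q < 1) (m j : ℕ) :
    0 ≤ tB q m j ∧ tB q m j ≤ q ^ j * ((1 / qpi q q) * (1 / qpi q q)) := by
  have hp := qpi_pos h0 h1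
  unfold tB
  split_ifs
  · refine ⟨mul_nonneg (by positivity) (qbinom_nonneg h0 h1 _ _), ?_⟩
    apply mul_le_mul _ (qbinom_le h0 h1 _ _) (qbinom_nonneg h0 h1 _ _) (by positivity)
    exact pow_le_pow_of_le_one h0.le h1.le (Nat.le_self_pow (by norm_num) j)
  · exact ⟨le_rfl, by positivity⟩

lemma geo_summ {q : ℝ} (h0 : 0 < q) (h1 : q < 1) (C : ℝ) : Summable fun j : ℕ => q ^ j * C :=
  (summable_geometric_of_lt_one h0.le h1).mul_right C

lemma tA_summ {q : ℝ} (h0 : 0 < q) (h1 : q < 1) (m : ℕ) : Summable (tA q m) :=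
  Summable.of_nonneg_of_le (fun j => (tA_bd h0 h1 m j).1) (fun j => (tA_bd h0 h1 m j).2)
    (geo_summ h0 h1 _)

lemma tB_summ {q : ℝ} (h0 : 0 < q) (h1 : q < 1) (m : ℕ) : Summable (tB q m) :=
  Summable.of_nonneg_of_le (fun j => (tB_bd h0 h1 m j).1) (fun j => (tB_bd h0 h1 m j).2)
    (geo_summ h0 h1 _)

lemma schurA_eq (q : ℝ) (m : ℕ) : schurA q m = ∑' j, tA q m j := rfl
lemma schurB_eq (q : ℝ) (m : ℕ) : schurB q m = ∑' j, tB q m j := rfl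

lemma rec_aux (t : ℕ → ℕ → ℝ) (hs : ∀ m, Summable (t m)) (m : ℕ) (c : ℝ)
    (h0 : t (m+2) 0 = t (m+1) 0) (h : ∀ j, t (m+2) (j+1) = t (m+1) (j+1) + c * t m j) :
    ∑' j, t (m+2) j = ∑' j, t (m+1) j + c * ∑' j, t m j := by
  rw [(hs (m+2)).tsum_eq_zero_add, (hs (m+1)).tsum_eq_zero_add, h0, ← tsum_mul_left, add_assoc,
    ← ((summable_nat_add_iff 1).mpr (hs (m+1))).tsum_add ((hs m).mul_left c)]
  congr 1
  exact tsum_congr h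

lemma schurA_rec {q : ℝ} (h0 : 0 < q) (h1 : q < 1) (m : ℕ) (hm : 1 ≤ m) :
    schurA q (m+2) = schurA q (m+1) + q ^ m * schurA q m := by
  apply rec_aux (tA q) (tA_summ h0 h1)
  · simp only [tA]
    rw [if_pos (by omega), if_pos (by omega), qbinom_zero h0 h1, qbinom_zero h0 h1]
  · intro j
    simp only [tA]
    by_cases h : j + 2 ≤ m
    · obtain ⟨n, rfl⟩ : ∃ n, m = n + j + 2 := ⟨m - j - 2, by omega⟩
      rw [if_pos (by omega), if_pos (by omega), if_pos (by omega),
        show n + j + 2 + 2 - (j+1) - 2 = n + 1 by omega,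
        show n + j + 2 + 1 - (j+1) - 2 = n by omega,
        show n + j + 2 - j - 2 = n by omega, qbinom_pascal h0 h1]
      rcases lt_or_ge n j with hj | hj
      · rw [qbinom_big q hj]; ring
      · obtain ⟨d, rfl⟩ := Nat.exists_eq_add_of_le hj
        rw [show j + d - j = d by omega]; ring
    · rw [if_neg (by omega : ¬ (j + 1 + 2 ≤ m + 1)), if_neg h]
      split_ifs
      · rw [qbinom_big q (by omega)]; ring
      · ring

lemma schurB_rec {q : ℝ} (h0 : 0 < q) (h1 : q < 1) (m : ℕ) :
    schurB q (m+2) = schurB q (m+1) + q ^ m * schurB q m := by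
  apply rec_aux (tB q) (tB_summ h0 h1)
  · simp only [tB]
    rw [if_pos (by omega), if_pos (by omega), qbinom_zero h0 h1, qbinom_zero h0 h1]
  · intro j
    simp only [tB]
    by_cases h : j + 1 ≤ m
    · obtain ⟨n, rfl⟩ : ∃ n, m = n + j + 1 := ⟨m - j - 1, by omega⟩
      rw [if_pos (by omega), if_pos (by omega), if_pos (by omega),
        show n + j + 1 + 2 - (j+1) - 1 = n + 1 by omega,
        show n + j + 1 + 1 - (j+1) - 1 = n by omega,
        show n + j + 1 - j - 1 = n by omega, qbinom_pascal h0 h1]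
      rcases lt_or_ge n j with hj | hj
      · rw [qbinom_big q hj]; ring
      · obtain ⟨d, rfl⟩ := Nat.exists_eq_add_of_le hj
        rw [show j + d - j = d by omega]; ring
    · rw [if_neg (by omega : ¬ (j + 1 + 1 ≤ m + 1)), if_neg h]
      split_ifs
      · rw [qbinom_big q (by omega)]; ring
      · ring

lemma schurA_one (q : ℝ) : schurA q 1 = 0 := by
  rw [schurA_eq]; convert tsum_zero with j; simp [tA]

lemma schurA_two {q : ℝ} (h0 : 0 < q) (h1 : q < 1) : schurA q 2 = 1 := by
  rw [schurA_eq, tsum_eq_single 0]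
  · simp [tA, qbinom_zero h0 h1]
  · intro j hj; simp [tA, hj]

lemma schurB_zero (q : ℝ) : schurB q 0 = 0 := by
  rw [schurB_eq]; convert tsum_zero with j; simp [tB]

lemma schurB_one {q : ℝ} (h0 : 0 < q) (h1 : q < 1) : schurB q 1 = 1 := by
  rw [schurB_eq, tsum_eq_single 0]
  · simp [tB, qbinom_zero h0 h1]
  · intro j hj; simp [tB, hj]

/-- Garrett-Ismail-Stanton -/
lemma gis {q : ℝ} (h0 : 0 < q) (h1 : q < 1) (m : ℕ) :
    ((-1) ^ (m+1) * q ^ (c2 (m+1)) * SS q (m+1) = schurA q (m+1) * SS q 0 - schurB q (m+1) * SS q 1)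
    ∧ ((-1) ^ (m+2) * q ^ (c2 (m+2)) * SS q (m+2) =
      schurA q (m+2) * SS q 0 - schurB q (m+2) * SS q 1) := by
  induction m with
  | zero =>
    have hb := schurB_rec h0 h1 0
    rw [schurB_zero] at hb
    have r := SS_rec h0 h1 (m := 0) le_rfl
    simp only [zero_add, mul_zero, add_zero] at hb r
    rw [zpow_one] at r
    constructor
    · simp [schurA_one, schurB_one h0 h1, c2]
    · simp only [Nat.cast_zero, zero_add]
      rw [schurA_two h0 h1, hb, schurB_one h0 h1]
      simp only [c2]
      norm_num
      linarith
  | succ m ih =>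
    obtain ⟨i1, i2⟩ := ih
    refine ⟨by push_cast; rw [show (m:ℤ) + 1 + 1 = m + 2 by ring]; exact i2, ?_⟩
    rw [show m + 1 + 2 = (m + 1) + 2 by ring, schurA_rec h0 h1 (m+1) (by omega), schurB_rec h0 h1 (m+1)]
    have r := SS_rec h0 h1 (m := (m:ℤ) + 1) (by omega)
    have c : c2 (((m+1 : ℕ):ℤ) + 2) = c2 ((m:ℤ)+2) + (m + 2) := by
      rw [← c2_succ]; push_cast; ring_nf
    have c' : c2 ((m:ℤ) + 2) = c2 ((m:ℤ)+1) + (m + 1) := by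
      rw [← c2_succ]; ring_nf
    rw [show (m:ℤ) + 1 + 1 = m + 2 by ring] at r
    have e1 : q ^ (c2 (((m+1 : ℕ):ℤ) + 2)) * SS q (((m+1 : ℕ):ℤ) + 2) =
        q ^ c2 ((m:ℤ)+2) * (SS q ((m:ℤ)+1) - SS q ((m:ℤ)+2)) := by
      rw [r, c, zpow_add₀ h0.ne']; push_cast; ring
    have e2 : q ^ c2 ((m:ℤ)+2) = q ^ c2 ((m:ℤ)+1) * q ^ (m+1) := by
      rw [c', zpow_add₀ h0.ne']; congr 1
    rw [mul_assoc, e1, mul_sub]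
    rw [show m + 1 + 1 = m + 2 by ring]
    rw [mul_sub]
    nth_rewrite 1 [e2]
    rw [pow_succ (-1:ℝ) (m+1+1), pow_succ (-1:ℝ) (m+1)]
    rw [pow_succ (-1:ℝ) (m+1)] at i2
    linear_combination q^(m+1) * i1 + i2

theorem schur_odd_identity (q : ℝ) (hq0 : 0 < q) (hq1 : q < 1) :
    qpi q (-q ^ 2) =
      (1 / (qpi (q ^ 5) (q ^ 2) * qpi (q ^ 5) (q ^ 3))) *
          ∑' n : ℕ, q ^ (2 * n) * schurB q (2 * n + 1) / qp (q ^ 2) (q ^ 2) n -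
        (1 / (qpi (q ^ 5) q * qpi (q ^ 5) (q ^ 4))) *
          ∑' n : ℕ, q ^ (2 * n) * schurA q (2 * n + 1) / qp (q ^ 2) (q ^ 2) n := by
  obtain ⟨r0, r1⟩ := RR1 hq0 hq1
  obtain ⟨g0, g1⟩ := q2 hq0 hq1
  rw [← r0, ← r1, ← dbl hq0 hq1]
  have hsum : ∀ f : ℕ → ℝ, (∃ K, ∀ m, 0 ≤ f m ∧ f m ≤ K) →
      Summable fun n : ℕ => q ^ (2 * n) * f (2 * n + 1) / qp (q ^ 2) (q ^ 2) n := by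
    rintro f ⟨K, hK⟩
    apply Summable.of_nonneg_of_le _ _ (geo_summ g0 g1 (K * (1 / qpi (q^2) (q^2))))
    · intro n
      exact div_nonneg (mul_nonneg (by positivity) (hK _).1) (qp_pos g0 g1 n).le
    · intro n
      have b := rr_le g0 g1 n
      rw [rr_nat] at b
      rw [div_eq_mul_one_div, pow_mul, mul_assoc]
      apply mul_le_mul_of_nonneg_left _ (by positivity)
      exact mul_le_mul (hK _).2 b (one_div_pos.mpr (qp_pos g0 g1 n)).le ((hK 0).1.trans (hK 0).2)
  have sA := hsum (schurA q) ⟨_, fun m => ⟨tsum_nonneg fun j => (tA_bd hq0 hq1 m j).1,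
    (tA_summ hq0 hq1 m).tsum_le_tsum (fun j => (tA_bd hq0 hq1 m j).2) (geo_summ hq0 hq1 _)⟩⟩
  have sB := hsum (schurB q) ⟨_, fun m => ⟨tsum_nonneg fun j => (tB_bd hq0 hq1 m j).1,
    (tB_summ hq0 hq1 m).tsum_le_tsum (fun j => (tB_bd hq0 hq1 m j).2) (geo_summ hq0 hq1 _)⟩⟩
  rw [← tsum_mul_left, ← tsum_mul_left, ← (sB.mul_left _).tsum_sub (sA.mul_left _),
    ← Function.Injective.tsum_eq Nat.cast_injective]
  · apply tsum_congr; intro n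
    have g := (gis hq0 hq1 (2 * n)).1
    have c : c2 (((2 * n : ℕ):ℤ) + 1) = 2 * n * n + n := by
      have := two_c2 (((2 * n : ℕ):ℤ) + 1)
      push_cast at this ⊢
      nlinarith
    rw [c, pow_succ, pow_mul] at g
    push_cast at g
    norm_num at g
    rw [rr_nat, show 2 * (n:ℤ) * n + 3 * n = (2 * n : ℕ) + (2 * n * n + n) by push_cast; ring,
      zpow_add₀ hq0.ne', zpow_natCast]
    linear_combination (- q ^ (2 * n) / qp (q ^ 2) (q ^ 2) n) * g
  · intro n hn
    rcases lt_or_ge n 0 with h | h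
    · exact absurd (by simp [rr_neg _ h]) hn
    · exact ⟨n.toNat, by simp [h]⟩
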